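/- There exists a constant C > 0 such that for all n ≥ 4 and all T ∈ BPT(n), the proportion of trees T' ∈ BPT(n) that share with T at least one nontrivial split both of whose sides have size at least 3 is at most C/n. Equivalently, if X_T counts all nontrivial splits shared between T and a uniformly random T' ∈ BPT(n), and X'_T counts only shared splits having a side of size exactly 2, then P(X_T ≠ X'_T) ≤ C/n. -/

import Mathlib

open scoped Classical symmDiff

noncomputable section

/-- `b n = (2n-5)!!`, the number of fully resolved phylogenetic trees on `n` leaves. -/
def numBPT (n : ℕ) : ℕ := ∏ k ∈ Finset.Icc 3 n, (2 * k - 5)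

/-- `G`, together with the leaf-labelling `leaf`, is a fully resolved (binary)
phylogenetic tree on the leaf set `{1,…,n}`: a tree whose degree-one vertices are
exactly the (injectively) labelled leaves, all other vertices having degree three. -/
def IsBinaryPhylo {V : Type} [Fintype V] (n : ℕ) (G : SimpleGraph V) (leaf : Fin n → V) : Prop :=
  G.IsTree ∧ Function.Injective leaf ∧
    (∀ i, G.degree (leaf i) = 1) ∧
    ∀ v : V, v ∉ Set.range leaf → G.degree v = 3

/-- The split (bipartition of the leaf-label set, as an unordered pair of subsets of
`Fin n`) induced by the edge `e`: each side consists of the labels of the leaves lying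
in the corresponding component of `G` with `e` deleted. -/
def splitOfEdge {V : Type} [Fintype V] (n : ℕ) (G : SimpleGraph V) (leaf : Fin n → V)
    (e : Sym2 V) : Sym2 (Finset (Fin n)) :=
  e.map (fun u => Finset.univ.filter (fun i => (G.deleteEdges {e}).Reachable (leaf i) u))

/-- `c(T)`: the set of splits of the phylogenetic tree. -/
def splitsOf {V : Type} [Fintype V] (n : ℕ) (G : SimpleGraph V) (leaf : Fin n → V) :
    Finset (Sym2 (Finset (Fin n))) :=
  G.edgeFinset.image (splitOfEdge n G leaf)

/-- A split is trivial if one of its sides is a singleton. -/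
def IsTrivialSplit {n : ℕ} (σ : Sym2 (Finset (Fin n))) : Prop :=
  ∃ A ∈ σ, A.card = 1

/-- The collection of split systems of fully resolved phylogenetic trees on `{1,…,n}`;
since a fully resolved phylogenetic tree is determined, up to isomorphism fixing the
leaf labels, by its set of splits, this collection is in bijection with `BPT(n)`.
(Every fully resolved tree on `n` leaves has `n-2` internal vertices, hence is
isomorphic to one with vertex set `Fin n ⊕ Fin (n-2)`, leaves labelled by `Sum.inl`.) -/
def allBPTSplits (n : ℕ) : Finset (Finset (Sym2 (Finset (Fin n)))) :=
  Finset.univ.filter (fun S => ∃ G : SimpleGraph (Fin n ⊕ Fin (n - 2)),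
    IsBinaryPhylo n G Sum.inl ∧ splitsOf n G Sum.inl = S)

/-- The number of cherries of the tree: pairs of (distinct) leaves adjacent to a
common vertex. -/
def numCherries {V : Type} [Fintype V] (n : ℕ) (G : SimpleGraph V) (leaf : Fin n → V) : ℕ :=
  (Finset.univ.filter
    (fun p : Sym2 (Fin n) => ¬ p.IsDiag ∧ ∃ v : V, ∀ i ∈ p, G.Adj (leaf i) v)).card

/-- The internal edges of the tree: edges both of whose endpoints are internal
(non-leaf) vertices. -/
def internalEdgesG {V : Type} [Fintype V] (n : ℕ) (G : SimpleGraph V) (leaf : Fin n → V) :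
    Finset (Sym2 V) :=
  G.edgeFinset.filter (fun e => ∀ v ∈ e, v ∉ Set.range leaf)

/-- `N_E(T) = ∏ᵢ β(|E̊(Fᵢ)|)`, the product over all connected components `Fᵢ` of the
forest `T - E` of the number `β(m) = b(m+3)` of fully resolved trees with `m` internal
edges, where `m = |E̊(Fᵢ)|` is the number of internal edges of `T` contained in `Fᵢ`. -/
def NEdges {V : Type} [Fintype V] (n : ℕ) (G : SimpleGraph V) (leaf : Fin n → V)
    (E : Finset (Sym2 V)) : ℕ :=
  ∏ C ∈ Finset.univ.image (G.deleteEdges (E : Set (Sym2 V))).connectedComponentMk,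
    numBPT ((((internalEdgesG n G leaf) \ E).filter
      (fun e => ∀ v ∈ e, (G.deleteEdges (E : Set (Sym2 V))).connectedComponentMk v = C)).card + 3)

/-- `r_s(T) = ∑_{E ⊆ E̊(T), |E| = s} N_E(T)`. -/
def rCoeff {V : Type} [Fintype V] (n : ℕ) (G : SimpleGraph V) (leaf : Fin n → V) (s : ℕ) : ℕ :=
  ∑ E ∈ (internalEdgesG n G leaf).powerset.filter (fun E => E.card = s), NEdges n G leaf E

/-- `q_s(T)`: the number of fully resolved phylogenetic trees on `{1,…,n}` (counted up
to isomorphism fixing leaf labels, i.e. counted via their split systems) sharing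
exactly `s` nontrivial splits with `T`. -/
def qCoeff {V : Type} [Fintype V] (n : ℕ) (G : SimpleGraph V) (leaf : Fin n → V) (s : ℕ) : ℕ :=
  ((allBPTSplits n).filter (fun S =>
    ((S ∩ splitsOf n G leaf).filter (fun σ => ¬ IsTrivialSplit σ)).card = s)).card

end

/-- binary hierarchies -/
inductive BH {n : ℕ} : Finset (Fin n) → Finset (Finset (Fin n)) → Prop
  | leaf (x : Fin n) : BH {x} {{x}}
  | node (A B : Finset (Fin n)) (H K : Finset (Finset (Fin n))) :
      Disjoint A B → BH A H → BH B K → BH (A ∪ B) (insert (A ∪ B) (H ∪ K))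

theorem BH.nonempty {n : ℕ} {A : Finset (Fin n)} {H} (h : BH A H) : A.Nonempty := by
  induction h with
  | leaf x => simp
  | node A B H K hd h1 h2 i1 i2 => exact i1.mono Finset.subset_union_left

theorem BH.sub {n : ℕ} {A : Finset (Fin n)} {H} (h : BH A H) :
    ∀ D ∈ H, D ⊆ A ∧ D.Nonempty := by
  induction h with
  | leaf x => simp
  | node A B H K hd h1 h2 i1 i2 =>
    intro D hD
    simp only [Finset.mem_insert, Finset.mem_union] at hD
    rcases hD with rfl | hD | hD
    · exact ⟨subset_rfl, h1.nonempty.mono Finset.subset_union_left⟩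
    · exact ⟨(i1 D hD).1.trans Finset.subset_union_left, (i1 D hD).2⟩
    · exact ⟨(i2 D hD).1.trans Finset.subset_union_right, (i2 D hD).2⟩

theorem BH.top {n : ℕ} {A : Finset (Fin n)} {H} (h : BH A H) : A ∈ H := by
  cases h <;> simp

theorem BH.card {n : ℕ} {A : Finset (Fin n)} {H} (h : BH A H) : H.card + 1 ≤ 2 * A.card := by
  induction h with
  | leaf x => simp
  | node A B H K hd h1 h2 i1 i2 =>
    have := Finset.card_insert_le (A ∪ B) (H ∪ K)
    have := Finset.card_union_le H K
    have := Finset.card_union_of_disjoint hd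
    omega

theorem BH.single {n : ℕ} {A : Finset (Fin n)} {H} (h : BH A H) : ∀ x ∈ A, {x} ∈ H := by
  induction h with
  | leaf x => simp
  | node A B H K hd h1 h2 i1 i2 =>
    intro x hx
    simp only [Finset.mem_insert, Finset.mem_union] at hx ⊢
    rcases hx with hx | hx
    · exact Or.inr (Or.inl (i1 x hx))
    · exact Or.inr (Or.inr (i2 x hx))

theorem BH.eq_single {n : ℕ} {A : Finset (Fin n)} {H} (h : BH A H) :
    ∀ x, A = {x} → H = {{x}} := by
  cases h with
  | leaf y => intro x hx; rw [hx]
  | node A B H K hd h1 h2 =>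
    intro x hx
    exfalso
    have := Finset.card_union_of_disjoint hd
    rw [hx] at this
    have := h1.nonempty.card_pos
    have := h2.nonempty.card_pos
    rw [Finset.card_singleton] at *
    omega

/-- insert leaf `x` above the cluster `C` -/
def insLeaf {n : ℕ} (x : Fin n) (C : Finset (Fin n)) (H : Finset (Finset (Fin n))) :
    Finset (Finset (Fin n)) :=
  insert {x} (insert C ((H.filter (fun D => ¬ C ⊆ D)) ∪ (H.filter (fun D => C ⊆ D)).image (insert x)))

theorem insLeaf_sibling {n : ℕ} {x : Fin n} {A : Finset (Fin n)} {H} (h : BH A H) :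
    insLeaf x A H = insert (insert x A) (insert {x} H) := by
  have h1 : ∀ D ∈ H, (A ⊆ D ↔ D = A) := fun D hD =>
    ⟨fun h' => subset_antisymm (h.sub D hD).1 h', fun h' => h' ▸ subset_rfl⟩
  have ht := h.top
  ext D
  simp only [insLeaf, Finset.mem_insert, Finset.mem_union, Finset.mem_filter, Finset.mem_image]
  constructor
  · rintro (rfl | rfl | ⟨h2, h3⟩ | ⟨E, ⟨h2, h3⟩, rfl⟩)
    · simp
    · simp [ht]
    · simp [h2]
    · rw [h1 E h2] at h3; simp [h3]
  · rintro (rfl | rfl | h2)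
    · exact Or.inr (Or.inr (Or.inr ⟨A, ⟨ht, subset_rfl⟩, rfl⟩))
    · simp
    · by_cases h3 : D = A
      · simp [h3]
      · exact Or.inr (Or.inr (Or.inl ⟨h2, by rwa [h1 D h2]⟩))

theorem insLeaf_node {n : ℕ} {x : Fin n} {A B C : Finset (Fin n)} {H K} (h : BH A H) (k : BH B K)
    (hd : Disjoint A B) (hC : C ∈ H) :
    insLeaf x C (insert (A ∪ B) (H ∪ K)) = insert (insert x (A ∪ B)) (insLeaf x C H ∪ K) := by
  have hCA := (h.sub C hC).1
  have hCn := (h.sub C hC).2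
  have hK : ∀ D ∈ K, ¬ C ⊆ D := by
    intro D hD hCD
    obtain ⟨y, hy⟩ := hCn
    exact Finset.disjoint_left.1 hd (hCA hy) ((k.sub D hD).1 (hCD hy))
  have hAB : C ⊆ A ∪ B := hCA.trans Finset.subset_union_left
  ext D
  simp only [insLeaf, Finset.mem_insert, Finset.mem_union, Finset.mem_filter, Finset.mem_image]
  constructor
  · rintro (rfl | rfl | ⟨rfl | h2 | h2, h3⟩ | ⟨E, ⟨rfl | h2 | h2, h3⟩, rfl⟩)
    · simp
    · simp
    · exact absurd hAB h3
    · simp [h2, h3]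
    · simp [h2]
    · simp
    · exact Or.inr (Or.inl (Or.inr (Or.inr (Or.inr ⟨E, ⟨h2, h3⟩, rfl⟩))))
    · exact absurd h3 (hK E h2)
  · rintro (rfl | (rfl | rfl | ⟨h2, h3⟩ | ⟨E, ⟨h2, h3⟩, rfl⟩) | h2)
    · exact Or.inr (Or.inr (Or.inr ⟨A ∪ B, ⟨by simp, hAB⟩, rfl⟩))
    · simp
    · simp
    · simp [h2, h3]
    · exact Or.inr (Or.inr (Or.inr ⟨E, ⟨by simp [h2], h3⟩, rfl⟩))
    · simp [h2, hK D h2]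

theorem BH.removal {n : ℕ} {A : Finset (Fin n)} {H} (h : BH A H) :
    ∀ x ∈ A, A ≠ {x} → ∃ H' C, BH (A.erase x) H' ∧ C ∈ H' ∧ H = insLeaf x C H' := by
  induction h with
  | leaf x => intro y hy; simp at hy; simp [hy]
  | node A B H K hd h1 h2 i1 i2 =>
    -- symmetric core
    have core : ∀ (A B : Finset (Fin n)) (H K : Finset (Finset (Fin n))), Disjoint A B → BH A H →
        BH B K → (∀ x ∈ A, A ≠ {x} → ∃ H' C, BH (A.erase x) H' ∧ C ∈ H' ∧ H = insLeaf x C H') →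
        ∀ x ∈ A, ∃ H' C, BH ((A ∪ B).erase x) H' ∧ C ∈ H' ∧
          insert (A ∪ B) (H ∪ K) = insLeaf x C H' := by
      intro A B H K hd h1 h2 i1 x hx
      have hxB : x ∉ B := Finset.disjoint_left.1 hd hx
      by_cases hA : A = {x}
      · refine ⟨K, B, ?_, h2.top, ?_⟩
        · rw [hA]
          have : ({x} ∪ B).erase x = B := by
            ext y; simp only [Finset.mem_erase, Finset.mem_union, Finset.mem_singleton]
            constructor
            · tauto
            · intro hy; exact ⟨fun h => hxB (h ▸ hy), Or.inr hy⟩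
          rwa [this]
        · rw [insLeaf_sibling h2, h1.eq_single x hA, hA]
          rw [← Finset.insert_eq, ← Finset.insert_eq]
      · obtain ⟨H', C, hb, hC, rfl⟩ := i1 x hx hA
        have hd' : Disjoint (A.erase x) B := hd.mono_left (Finset.erase_subset _ _)
        have e : (A ∪ B).erase x = A.erase x ∪ B := by
          rw [Finset.erase_union_distrib, Finset.erase_eq_of_notMem hxB]
        refine ⟨_, C, e ▸ BH.node _ _ _ _ hd' hb h2, by simp [hC], ?_⟩
        rw [e, insLeaf_node hb h2 hd' hC, ← e, Finset.insert_erase (by simp [hx])]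
    intro x hx hne
    rcases Finset.mem_union.1 hx with hx | hx
    · exact core A B H K hd h1 h2 i1 x hx
    · have := core B A K H hd.symm h2 h1 i2 x hx
      rwa [Finset.union_comm B A, Finset.union_comm K H] at this

theorem BH.card_not_ssub {n : ℕ} {A : Finset (Fin n)} {H} (h : BH A H) :
    ∀ B ∈ H, (H.filter (fun C => ¬ C ⊂ B)).card ≤ 2 * (A \ B).card + 1 := by
  induction h with
  | leaf x =>
    intro B hB
    refine (Finset.card_filter_le _ _).trans ?_
    simp
  | node A B H K hd h1 h2 i1 i2 =>
    have core : ∀ (A B : Finset (Fin n)) (H K : Finset (Finset (Fin n))), Disjoint A B → BH A H →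
        BH B K → (∀ D ∈ H, (H.filter (fun C => ¬ C ⊂ D)).card ≤ 2 * (A \ D).card + 1) →
        ∀ D ∈ H, ((insert (A ∪ B) (H ∪ K)).filter (fun C => ¬ C ⊂ D)).card
          ≤ 2 * ((A ∪ B) \ D).card + 1 := by
      intro A B H K hd h1 h2 i1 D hD
      have hDA := (h1.sub D hD).1
      have e1 : ((A ∪ B) \ D).card = (A \ D).card + B.card := by
        have : (A ∪ B) \ D = A \ D ∪ B := by
          rw [Finset.union_sdiff_distrib, Finset.sdiff_eq_self_of_disjoint (hd.symm.mono_right hDA)]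
        rw [this, Finset.card_union_of_disjoint (hd.mono_left Finset.sdiff_subset)]
      have e2 := i1 D hD
      have e3 := h2.card
      have e4 : ((insert (A ∪ B) (H ∪ K)).filter (fun C => ¬ C ⊂ D)) ⊆
          insert (A ∪ B) ((H.filter (fun C => ¬ C ⊂ D)) ∪ K) := by
        intro E hE
        simp only [Finset.mem_filter, Finset.mem_insert, Finset.mem_union] at hE ⊢
        tauto
      have e5 := Finset.card_le_card e4
      have e6 := Finset.card_insert_le (A ∪ B) ((H.filter (fun C => ¬ C ⊂ D)) ∪ K)
      have e7 := Finset.card_union_le (H.filter (fun C => ¬ C ⊂ D)) K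
      omega
    intro D hD
    simp only [Finset.mem_insert, Finset.mem_union] at hD
    rcases hD with rfl | hD | hD
    · have : (insert (A ∪ B) (H ∪ K)).filter (fun C => ¬ C ⊂ A ∪ B) ⊆ {A ∪ B} := by
        intro E hE
        rw [Finset.mem_filter] at hE
        have := ((BH.node _ _ _ _ hd h1 h2).sub E hE.1).1
        rw [Finset.mem_singleton]
        by_contra hne
        exact hE.2 (this.ssubset_of_ne hne)
      have := Finset.card_le_card this
      rw [Finset.card_singleton] at this
      omega
    · exact core A B H K hd h1 h2 i1 D hD
    · have := core B A K H hd.symm h2 h1 i2 D hD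
      rwa [Finset.union_comm B A, Finset.union_comm K H] at this

/-- hierarchies on `X` containing the cluster `B` -/
noncomputable def hier {n : ℕ} (X B : Finset (Fin n)) : Finset (Finset (Finset (Fin n))) :=
  Finset.univ.filter (fun H => BH X H ∧ B ∈ H)

theorem hier_step {n : ℕ} (X B : Finset (Fin n)) (x : Fin n) (hx : x ∈ X) (hxB : x ∉ B)
    (hB : B.Nonempty) (hBX : B ⊆ X) :
    (hier X B).card ≤ (hier (X.erase x) B).card * (2 * (X.erase x \ B).card + 1) := by
  have hsub : hier X B ⊆ (hier (X.erase x) B).biUnion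
      (fun H' => (H'.filter (fun C => ¬ C ⊂ B)).image (fun C => insLeaf x C H')) := by
    intro H hH
    simp only [hier, Finset.mem_filter, Finset.mem_univ, true_and] at hH
    obtain ⟨hb, hBH⟩ := hH
    have hne : X ≠ {x} := by
      rintro rfl
      obtain ⟨y, hy⟩ := hB
      have := Finset.mem_singleton.1 (hBX hy)
      exact hxB (this ▸ hy)
    obtain ⟨H', C, hb', hC, rfl⟩ := hb.removal x hx hne
    have key : B ∈ H' ∧ ¬ C ⊂ B := by
      simp only [insLeaf, Finset.mem_insert, Finset.mem_union, Finset.mem_filter,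
        Finset.mem_image] at hBH
      rcases hBH with rfl | rfl | ⟨h2, h3⟩ | ⟨E, ⟨h2, h3⟩, rfl⟩
      · simp at hxB
      · exact ⟨hC, fun h => h.ne rfl⟩
      · exact ⟨h2, fun h => h3 h.subset⟩
      · simp at hxB
    simp only [Finset.mem_biUnion, hier, Finset.mem_filter, Finset.mem_univ, true_and,
      Finset.mem_image]
    exact ⟨H', ⟨hb', key.1⟩, C, ⟨hC, key.2⟩, rfl⟩
  refine (Finset.card_le_card hsub).trans (Finset.card_biUnion_le_card_mul _ _ _ ?_)
  intro H' hH'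
  simp only [hier, Finset.mem_filter, Finset.mem_univ, true_and] at hH'
  exact Finset.card_image_le.trans (hH'.1.card_not_ssub B hH'.2)

theorem numBPT_succ (m : ℕ) : numBPT (m + 3) = numBPT (m + 2) * (2 * m + 1) := by
  unfold numBPT
  rw [Finset.prod_Icc_succ_top (by omega)]
  congr 1

theorem hier_le {n : ℕ} (B : Finset (Fin n)) (hB : B.Nonempty) (k : ℕ) :
    ∀ X : Finset (Fin n), B ⊆ X → (X \ B).card = k →
      (hier X B).card ≤ (hier B B).card * numBPT (k + 2) := by
  induction k with
  | zero =>
    intro X hX hk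
    have : X = B := subset_antisymm (by simpa using hk) hX
    subst this
    simp [numBPT]
  | succ k ih =>
    intro X hX hk
    obtain ⟨x, hx⟩ : (X \ B).Nonempty := Finset.card_pos.1 (by omega)
    rw [Finset.mem_sdiff] at hx
    have e : (X.erase x \ B).card = k := by
      rw [Finset.erase_sdiff_comm, Finset.card_erase_of_mem (by simp [hx]), hk]; rfl
    have h1 := hier_step X B x hx.1 hx.2 hB hX
    have h2 := ih (X.erase x) (fun y hy => Finset.mem_erase.2 ⟨fun h => hx.2 (h ▸ hy), hX hy⟩) e
    rw [e] at h1
    calc _ ≤ _ := h1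
      _ ≤ _ := Nat.mul_le_mul_right _ h2
      _ = _ := by rw [numBPT_succ, mul_assoc]

theorem hier_count {n : ℕ} (X B : Finset (Fin n)) (hB : B.Nonempty) (hX : B ⊆ X) :
    (hier X B).card ≤ numBPT (B.card + 1) * numBPT ((X \ B).card + 2) := by
  refine (hier_le B hB _ X hX rfl).trans (Nat.mul_le_mul_right _ ?_)
  obtain ⟨b, hb⟩ := hB
  have hs : hier B B ⊆ hier B {b} := by
    intro H hH
    simp only [hier, Finset.mem_filter, Finset.mem_univ, true_and] at hH ⊢
    exact ⟨hH.1, hH.1.single b hb⟩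
  have h1 := hier_le {b} (by simp) _ B (by simpa using hb) rfl
  have h2 : (hier ({b} : Finset (Fin n)) {b}).card ≤ 1 := by
    rw [Finset.card_le_one]
    intro H hH K hK
    simp only [hier, Finset.mem_filter, Finset.mem_univ, true_and] at hH hK
    rw [hH.1.eq_single b rfl, hK.1.eq_single b rfl]
  have h3 : (B \ {b}).card + 2 = B.card + 1 := by
    have := Finset.card_sdiff_add_card_eq_card (s := {b}) (t := B) (by simpa using hb)
    rw [Finset.card_singleton] at this
    omega
  rw [h3] at h1
  calc _ ≤ _ := Finset.card_le_card hs
    _ ≤ _ := h1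
    _ ≤ 1 * _ := Nat.mul_le_mul_right _ h2
    _ = _ := one_mul _

theorem numBPT_conv (b c : ℕ) :
    numBPT (b + 4) * numBPT (c + 4) * ((2 * (b + c) + 7) * (2 * (b + c) + 5))
      ≤ 3 * numBPT (b + c + 6) := by
  induction c with
  | zero =>
    have : numBPT 4 = 3 := by decide
    rw [Nat.zero_add, this, numBPT_succ (b + 0 + 3), numBPT_succ (b + 0 + 2)]
    apply le_of_eq
    simp
    ring
  | succ c ih =>
    have e1 : numBPT (c + 1 + 4) = numBPT (c + 4) * (2 * c + 5) := by
      rw [numBPT_succ (c + 2)]; ring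
    have e2 : numBPT (b + (c + 1) + 6) = numBPT (b + c + 6) * (2 * (b + c) + 9) := by
      rw [show b + (c + 1) + 6 = (b + c + 4) + 3 by ring, numBPT_succ]; ring
    rw [e1, e2]
    calc _ = (numBPT (b + 4) * numBPT (c + 4)) * ((2 * (b + c) + 9) * (2 * (b + c) + 7)) * (2 * c + 5) := by ring
      _ ≤ (numBPT (b + 4) * numBPT (c + 4)) * ((2 * (b + c) + 9) * (2 * (b + c) + 7)) * (2 * (b + c) + 5) := by
        gcongr; omega
      _ = (numBPT (b + 4) * numBPT (c + 4) * ((2 * (b + c) + 7) * (2 * (b + c) + 5))) * (2 * (b + c) + 9) := by ring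
      _ ≤ _ := Nat.mul_le_mul_right _ ih
      _ = _ := by ring

section graphs

variable {V : Type}

/-- vertices on the `v` side of the edge `uv` -/
def sideD (G : SimpleGraph V) (u v : V) : Set V := {w | (G.deleteEdges {s(u, v)}).Reachable w v}

theorem sideD_self (G : SimpleGraph V) (u v : V) : v ∈ sideD G u v := SimpleGraph.Reachable.refl _

theorem sideD_step {G : SimpleGraph V} {u v y z : V} (hy : y ∈ sideD G u v) (h : G.Adj y z)
    (hne : s(y, z) ≠ s(u, v)) : z ∈ sideD G u v := by
  have : (G.deleteEdges {s(u, v)}).Adj z y := by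
    rw [SimpleGraph.deleteEdges_adj]
    exact ⟨h.symm, fun e => hne (by rw [Sym2.eq_swap]; exact Set.mem_singleton_iff.1 e)⟩
  exact this.reachable.trans hy

theorem sideD_total {G : SimpleGraph V} (hG : G.IsTree) {u v : V} (w : V) :
    w ∈ sideD G u v ∨ w ∈ sideD G v u := by
  obtain ⟨p⟩ := hG.1.preconnected w v
  induction p with
  | nil => exact Or.inl (sideD_self _ _ _)
  | @cons a b c h p ih =>
    by_cases e : s(b, a) = s(u, c)
    · rw [Sym2.eq_iff] at e
      rcases e with ⟨_, rfl⟩ | ⟨_, rfl⟩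
      · exact Or.inl (sideD_self _ _ _)
      · exact Or.inr (sideD_self _ _ _)
    · rcases ih with h1 | h1
      · exact Or.inl (sideD_step h1 h.symm e)
      · exact Or.inr (sideD_step h1 h.symm (by rwa [Sym2.eq_swap (a := c)]))

theorem sideD_disj {G : SimpleGraph V} (hG : G.IsTree) {u v w : V} (h : G.Adj u v)
    (h1 : w ∈ sideD G u v) (h2 : w ∈ sideD G v u) : False := by
  have hb := SimpleGraph.isAcyclic_iff_forall_adj_isBridge.1 hG.2 h
  rw [SimpleGraph.isBridge_iff] at hb
  change (G.deleteEdges {s(u, v)}).Reachable w v at h1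
  change (G.deleteEdges {s(v, u)}).Reachable w u at h2
  rw [Sym2.eq_swap (a := v)] at h2
  have := h2.symm.trans h1
  first
    | exact hb.2 this
    | exact hb this

theorem sideD_sub {G : SimpleGraph V} {u v a b : V} (hb : b ∈ sideD G u v)
    (hu : u ∉ sideD G a b) : sideD G a b ⊆ sideD G u v := by
  intro x hx
  obtain ⟨p⟩ := hx
  have : ∀ x t (p : (G.deleteEdges {s(a, b)}).Walk x t), t = b →
      x ∈ sideD G u v ∧ x ∈ sideD G a b := by
    intro x t p ht
    induction p with
    | nil => rw [ht]; exact ⟨hb, sideD_self _ _ _⟩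
    | @cons x z t h p ih =>
      obtain ⟨h1, h2⟩ := ih ht
      have hx : x ∈ sideD G a b := h.reachable.trans h2
      refine ⟨?_, hx⟩
      have hadj := h
      rw [SimpleGraph.deleteEdges_adj] at hadj
      refine sideD_step h1 hadj.1.symm ?_
      intro e
      rw [Sym2.eq_iff] at e
      rcases e with ⟨rfl, rfl⟩ | ⟨rfl, rfl⟩
      · exact hu h2
      · exact hu hx
  exact (this x b p rfl).1

theorem sideD_child {G : SimpleGraph V} (hG : G.IsTree) {u v w : V} (huv : G.Adj u v)
    (hvw : G.Adj v w) (hne : w ≠ u) : sideD G v w ⊆ sideD G u v := by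
  apply sideD_sub
  · refine sideD_step (sideD_self G u v) hvw ?_
    intro e
    rw [Sym2.eq_iff] at e
    rcases e with ⟨rfl, rfl⟩ | ⟨_, e⟩
    · exact huv.ne rfl
    · exact hne e
  · intro hu
    refine sideD_disj hG hvw hu (sideD_step (sideD_self G w v) huv.symm ?_)
    intro e
    rw [Sym2.eq_iff] at e
    rcases e with ⟨rfl, rfl⟩ | ⟨_, e⟩
    · exact huv.ne rfl
    · exact hne e.symm

theorem sideD_child_disj {G : SimpleGraph V} (hG : G.IsTree) {v w w' x : V}
    (h : G.Adj v w) (h' : G.Adj v w') (hne : w ≠ w') (hx : x ∈ sideD G v w)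
    (hx' : x ∈ sideD G v w') : False :=
  sideD_disj hG h hx (sideD_child hG h.symm h' hne.symm hx')

theorem sideD_cases {G : SimpleGraph V} {u v x : V} (hx : x ∈ sideD G u v) :
    x = v ∨ ∃ w, G.Adj v w ∧ w ≠ u ∧ x ∈ sideD G v w := by
  obtain ⟨p⟩ := hx
  have : ∀ x t (p : (G.deleteEdges {s(u, v)}).Walk x t), t = v →
      x = v ∨ ∃ w, G.Adj v w ∧ w ≠ u ∧ x ∈ sideD G v w := by
    intro x t p ht
    induction p with
    | nil => exact Or.inl ht
    | @cons x z t h p ih =>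
      rw [SimpleGraph.deleteEdges_adj] at h
      obtain ⟨h, hne⟩ := h
      by_cases hxv : x = v
      · exact Or.inl hxv
      right
      rcases ih ht with rfl | ⟨w, hw, hwu, hz⟩
      · refine ⟨x, h.symm, ?_, sideD_self _ _ _⟩
        rintro rfl
        exact hne rfl
      · refine ⟨w, hw, hwu, ?_⟩
        by_cases e : s(z, x) = s(v, w)
        · rw [Sym2.eq_iff] at e
          rcases e with ⟨_, rfl⟩ | ⟨_, e⟩
          · exact sideD_self _ _ _
          · exact absurd e hxv
        · exact sideD_step hz h.symm e
  exact this x v p rfl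

/-- the cluster of the directed edge `uv` -/
noncomputable def clus {n : ℕ} (G : SimpleGraph V) (leaf : Fin n → V) (u v : V) :
    Finset (Fin n) := Finset.univ.filter (fun i => leaf i ∈ sideD G u v)

/-- darts below a dart -/
theorem dart_sub_cases {G : SimpleGraph V} (hG : G.IsTree) {u v a b : V} (huv : G.Adj u v)
    (hab : G.Adj a b) (hs : sideD G a b ⊆ sideD G u v) :
    (a = u ∧ b = v) ∨ ∃ w, G.Adj v w ∧ w ≠ u ∧ sideD G a b ⊆ sideD G v w := by
  have hu : u ∉ sideD G a b := fun h => sideD_disj hG huv (hs h) (sideD_self _ _ _)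
  by_cases hv : v ∈ sideD G a b
  · by_cases e : s(v, u) = s(a, b)
    · rw [Sym2.eq_iff] at e
      rcases e with ⟨rfl, rfl⟩ | ⟨rfl, rfl⟩
      · exact absurd (sideD_self _ _ _) hu
      · exact Or.inl ⟨rfl, rfl⟩
    · exact absurd (sideD_step hv huv.symm e) hu
  · right
    rcases sideD_cases (hs (sideD_self G a b)) with rfl | ⟨w, hw, hwu, hb⟩
    · exact absurd (sideD_self _ _ _) hv
    · exact ⟨w, hw, hwu, sideD_sub hb hv⟩

theorem neighbors_leaf [Fintype V] {G : SimpleGraph V} {u v w : V} (h : G.degree v = 1)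
    (hu : G.Adj v u) (hw : G.Adj v w) : w = u := by
  rw [← SimpleGraph.card_neighborFinset_eq_degree, Finset.card_eq_one] at h
  obtain ⟨a, ha⟩ := h
  have h1 : u ∈ G.neighborFinset v := by simpa using hu
  have h2 : w ∈ G.neighborFinset v := by simpa using hw
  rw [ha, Finset.mem_singleton] at h1 h2
  rw [h1, h2]

theorem neighbors_three [Fintype V] {G : SimpleGraph V} {u v : V} (h : G.degree v = 3)
    (hu : G.Adj v u) : ∃ p q, p ≠ q ∧ G.Adj v p ∧ G.Adj v q ∧ p ≠ u ∧ q ≠ u ∧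
      ∀ w, G.Adj v w → w ≠ u → w = p ∨ w = q := by
  have h1 : u ∈ G.neighborFinset v := by simpa using hu
  have h2 : ((G.neighborFinset v).erase u).card = 2 := by
    rw [Finset.card_erase_of_mem h1, SimpleGraph.card_neighborFinset_eq_degree, h]
  rw [Finset.card_eq_two] at h2
  obtain ⟨p, q, hpq, he⟩ := h2
  have hm : ∀ w, (w ≠ u ∧ G.Adj v w) ↔ (w = p ∨ w = q) := by
    intro w
    have := Finset.ext_iff.1 he w
    simpa using this
  have hp := (hm p).2 (Or.inl rfl)
  have hq := (hm q).2 (Or.inr rfl)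
  exact ⟨p, q, hpq, hp.2, hq.2, hp.1, hq.1, fun w h h' => (hm w).1 ⟨h', h⟩⟩

theorem exists_hier [Fintype V] {n : ℕ} {G : SimpleGraph V} {leaf : Fin n → V}
    (hT : IsBinaryPhylo n G leaf) (k : ℕ) : ∀ u v : V, G.Adj u v → (sideD G u v).ncard ≤ k →
    ∃ H, BH (clus G leaf u v) H ∧ ∀ B, B ∈ H ↔ ∃ a b, G.Adj a b ∧ sideD G a b ⊆ sideD G u v ∧
      clus G leaf a b = B := by
  have hG := hT.1
  induction k with
  | zero =>
    intro u v _ hk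
    have : (sideD G u v).ncard = 0 := by omega
    rw [Set.ncard_eq_zero (Set.toFinite _)] at this
    exact absurd (sideD_self G u v) (by simp [this])
  | succ k ih =>
    intro u v huv hk
    by_cases hv : v ∈ Set.range leaf
    · obtain ⟨i, rfl⟩ := hv
      have hnb : ∀ w, G.Adj (leaf i) w → w = u := fun w hw =>
        neighbors_leaf (hT.2.2.1 i) huv.symm hw
      have hcl : clus G leaf u (leaf i) = {i} := by
        ext j
        simp only [clus, Finset.mem_filter, Finset.mem_univ, true_and, Finset.mem_singleton]
        constructor
        · intro hj
          rcases sideD_cases hj with h | ⟨w, hw, hwu, _⟩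
          · exact hT.2.1 h
          · exact absurd (hnb w hw) hwu
        · rintro rfl
          exact sideD_self _ _ _
      refine ⟨{{i}}, hcl ▸ BH.leaf i, ?_⟩
      intro B
      rw [Finset.mem_singleton]
      constructor
      · rintro rfl
        exact ⟨u, leaf i, huv, subset_rfl, hcl⟩
      · rintro ⟨a, b, hab, hs, rfl⟩
        rcases dart_sub_cases hG huv hab hs with ⟨rfl, rfl⟩ | ⟨w, hw, hwu, _⟩
        · exact hcl
        · exact absurd (hnb w hw) hwu
    · obtain ⟨p, q, hpq, hp, hq, hpu, hqu, hall⟩ := neighbors_three (hT.2.2.2 v hv) huv.symm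
      have hlt : ∀ w, G.Adj v w → w ≠ u → (sideD G v w).ncard ≤ k := by
        intro w hw hwu
        have : sideD G v w ⊂ sideD G u v := by
          refine ⟨sideD_child hG huv hw hwu, fun h => ?_⟩
          exact sideD_disj hG hw (h (sideD_self G u v)) (sideD_self _ _ _)
        have := Set.ncard_lt_ncard this (Set.toFinite _)
        omega
      obtain ⟨H, hH, hHm⟩ := ih v p hp (hlt p hp hpu)
      obtain ⟨K, hK, hKm⟩ := ih v q hq (hlt q hq hqu)
      have hcl : clus G leaf u v = clus G leaf v p ∪ clus G leaf v q := by
        ext j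
        simp only [clus, Finset.mem_filter, Finset.mem_univ, true_and, Finset.mem_union]
        constructor
        · intro hj
          rcases sideD_cases hj with h | ⟨w, hw, hwu, hj'⟩
          · exact absurd ⟨j, h⟩ hv
          · rcases hall w hw hwu with rfl | rfl
            · exact Or.inl hj'
            · exact Or.inr hj'
        · rintro (h | h)
          · exact sideD_child hG huv hp hpu h
          · exact sideD_child hG huv hq hqu h
      have hdis : Disjoint (clus G leaf v p) (clus G leaf v q) := by
        rw [Finset.disjoint_left]
        intro j h1 h2
        simp only [clus, Finset.mem_filter, Finset.mem_univ, true_and] at h1 h2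
        exact sideD_child_disj hG hp hq hpq h1 h2
      refine ⟨_, hcl ▸ BH.node _ _ _ _ hdis hH hK, ?_⟩
      intro B
      rw [Finset.mem_insert, Finset.mem_union, hHm, hKm]
      constructor
      · rintro (rfl | ⟨a, b, hab, hs, rfl⟩ | ⟨a, b, hab, hs, rfl⟩)
        · exact ⟨u, v, huv, subset_rfl, rfl⟩
        · exact ⟨a, b, hab, hs.trans (sideD_child hG huv hp hpu), rfl⟩
        · exact ⟨a, b, hab, hs.trans (sideD_child hG huv hq hqu), rfl⟩
      · rintro ⟨a, b, hab, hs, rfl⟩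
        rcases dart_sub_cases hG huv hab hs with ⟨rfl, rfl⟩ | ⟨w, hw, hwu, hs'⟩
        · exact Or.inl rfl
        · right
          rcases hall w hw hwu with rfl | rfl
          · exact Or.inl ⟨a, b, hab, hs', rfl⟩
          · exact Or.inr ⟨a, b, hab, hs', rfl⟩

theorem clus_compl {n : ℕ} {G : SimpleGraph V} (hG : G.IsTree) (leaf : Fin n → V) {a b : V}
    (h : G.Adj a b) : clus G leaf b a = (clus G leaf a b)ᶜ := by
  ext j
  simp only [clus, Finset.mem_filter, Finset.mem_univ, true_and, Finset.mem_compl]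
  constructor
  · intro h1 h2
    exact sideD_disj hG h h2 h1
  · intro h1
    exact (sideD_total hG (leaf j)).resolve_left h1

theorem splitOfEdge_eq [Fintype V] {n : ℕ} {G : SimpleGraph V} (hG : G.IsTree)
    (leaf : Fin n → V) {a b : V} (h : G.Adj a b) :
    splitOfEdge n G leaf s(a, b) = s(clus G leaf a b, (clus G leaf a b)ᶜ) := by
  rw [← clus_compl hG leaf h, Sym2.eq_swap (a := clus G leaf a b)]
  unfold splitOfEdge
  rw [Sym2.map_mk]
  have e1 : ∀ u v, clus G leaf u v = Finset.univ.filter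
      (fun i => (G.deleteEdges {s(u, v)}).Reachable (leaf i) v) := by
    intro u v
    unfold clus
    ext i
    rw [Finset.mem_filter, Finset.mem_filter]
    rfl
  rw [e1, e1, Sym2.eq_swap (a := b) (b := a)]

theorem splits_hier [Fintype V] {n : ℕ} {G : SimpleGraph V} {leaf : Fin n → V}
    (hT : IsBinaryPhylo n G leaf) (r : Fin n) :
    ∃ H, BH (Finset.univ.erase r) H ∧
      splitsOf n G leaf = H.image (fun B => s(B, Bᶜ)) := by
  have hG := hT.1
  have hd := hT.2.2.1 r
  obtain ⟨c, hc⟩ : ∃ c, G.Adj (leaf r) c := by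
    have : 0 < G.degree (leaf r) := by omega
    rwa [SimpleGraph.degree_pos_iff_exists_adj] at this
  obtain ⟨H, hH, hm⟩ := exists_hier hT _ (leaf r) c hc le_rfl
  have hside : ∀ x, x ∈ sideD G (leaf r) c ↔ x ≠ leaf r := by
    intro x
    constructor
    · rintro h rfl
      exact sideD_disj hG hc h (sideD_self _ _ _)
    · intro hx
      rcases sideD_total hG (u := leaf r) (v := c) x with h | h
      · exact h
      · rcases sideD_cases h with h | ⟨w, hw, hwc, _⟩
        · exact absurd h hx
        · exact absurd (neighbors_leaf hd hc hw) hwc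
  have hcl : clus G leaf (leaf r) c = Finset.univ.erase r := by
    ext j
    simp [clus, hside, hT.2.1.eq_iff]
  rw [hcl] at hH
  refine ⟨H, hH, ?_⟩
  ext σ
  simp only [splitsOf, Finset.mem_image, hm]
  constructor
  · rintro ⟨e, he, rfl⟩
    rw [SimpleGraph.mem_edgeFinset] at he
    induction e using Sym2.ind with
    | _ a b =>
      rw [SimpleGraph.mem_edgeSet] at he
      have key : ∀ a b, G.Adj a b → leaf r ∉ sideD G a b →
          ∃ B, (∃ a b, G.Adj a b ∧ sideD G a b ⊆ sideD G (leaf r) c ∧ clus G leaf a b = B) ∧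
            s(B, Bᶜ) = splitOfEdge n G leaf s(a, b) := by
        intro a b hab hr
        refine ⟨_, ⟨a, b, hab, ?_, rfl⟩, (splitOfEdge_eq hG leaf hab).symm⟩
        intro x hx
        rw [hside]
        rintro rfl
        exact hr hx
      by_cases hr : leaf r ∈ sideD G a b
      · rw [Sym2.eq_swap]
        exact key b a he.symm (fun h => sideD_disj hG he hr h)
      · exact key a b he hr
  · rintro ⟨B, ⟨a, b, hab, _, rfl⟩, rfl⟩
    exact ⟨s(a, b), by simpa using hab, splitOfEdge_eq hG leaf hab⟩

end graphs

/-- There is a constant `C > 0` such that for all `n ≥ 4` and all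
`T ∈ BPT(n)`, the proportion of trees `T' ∈ BPT(n)` that share with `T` at least one
nontrivial split both of whose sides have size at least `3` is at most `C/n`. -/
theorem proportion_sharing_deep_split_le :
    ∃ C : ℝ, 0 < C ∧ ∀ n : ℕ, 4 ≤ n →
      ∀ (V : Type) (_ : Fintype V) (G : SimpleGraph V) (leaf : Fin n → V),
        IsBinaryPhylo n G leaf →
        (((allBPTSplits n).filter (fun S =>
            ∃ σ ∈ S ∩ splitsOf n G leaf, ¬ IsTrivialSplit σ ∧ ∀ A ∈ σ, 3 ≤ A.card)).card : ℝ)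
            / (numBPT n) ≤ C / n := by
  refine ⟨10, by norm_num, ?_⟩
  intro n hn V _ G leaf hT
  have hpos : 0 < numBPT n := Finset.prod_pos (fun k hk => by
    rw [Finset.mem_Icc] at hk; omega)
  set F := (allBPTSplits n).filter (fun S =>
    ∃ σ ∈ S ∩ splitsOf n G leaf, ¬ IsTrivialSplit σ ∧ ∀ A ∈ σ, 3 ≤ A.card) with hF
  have hmain : F.card * ((2 * n - 5) * (2 * n - 7)) ≤ (2 * n - 3) * (3 * numBPT n) ∧
      (n < 6 → F.card = 0) := by
    let r : Fin n := ⟨0, by omega⟩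
    obtain ⟨H₀, hH₀, hS₀⟩ := splits_hier hT r
    let Q := H₀.filter (fun B => 3 ≤ B.card ∧ 3 ≤ (Bᶜ).card)
    have hsub : F ⊆ Q.biUnion (fun B => (hier (Finset.univ.erase r) B).image
        (fun H => H.image (fun B => s(B, Bᶜ)))) := by
      intro S hS
      rw [hF, Finset.mem_filter] at hS
      obtain ⟨hSa, σ, hσ, -, hdeep⟩ := hS
      unfold allBPTSplits at hSa
      rw [Finset.mem_filter] at hSa
      obtain ⟨-, G', hG', hS'⟩ := hSa
      obtain ⟨H, hH, hHS⟩ := splits_hier hG' r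
      rw [Finset.mem_inter, hS₀, ← hS', hHS, Finset.mem_image, Finset.mem_image] at hσ
      obtain ⟨⟨B, hB, rfl⟩, B', hB', he⟩ := hσ
      have hrB : r ∉ B := fun h => by simpa using (hH.sub B hB).1 h
      have hrB' : r ∉ B' := fun h => by simpa using (hH₀.sub B' hB').1 h
      have hBB : B' = B := by
        rw [Sym2.eq_iff] at he
        rcases he with h | h
        · exact h.1
        · exact absurd (h.1 ▸ Finset.mem_compl.2 hrB : r ∈ B') hrB'
      subst hBB
      simp only [Finset.mem_biUnion, Finset.mem_image]
      refine ⟨B', ?_, H, ?_, ?_⟩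
      · rw [Finset.mem_filter]
        exact ⟨hB', hdeep _ (by simp), hdeep _ (by simp)⟩
      · simp [hier, hH, hB]
      · rw [← hS', hHS]
    have hQ : Q.card ≤ 2 * n - 3 := by
      have h1 := hH₀.card
      have h2 : (Finset.univ.erase r).card = n - 1 := by simp
      have h3 := Finset.card_filter_le H₀ (fun B => 3 ≤ B.card ∧ 3 ≤ (Bᶜ).card)
      have h4 : Q.card ≤ H₀.card := h3
      omega
    have hcard : F.card ≤ ∑ B ∈ Q, (hier (Finset.univ.erase r) B).card := by
      refine (Finset.card_le_card hsub).trans (Finset.card_biUnion_le.trans ?_)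
      exact Finset.sum_le_sum (fun B _ => Finset.card_image_le)
    constructor
    · calc _ ≤ (∑ B ∈ Q, (hier (Finset.univ.erase r) B).card) * ((2 * n - 5) * (2 * n - 7)) :=
            Nat.mul_le_mul_right _ hcard
        _ = ∑ B ∈ Q, (hier (Finset.univ.erase r) B).card * ((2 * n - 5) * (2 * n - 7)) :=
            Finset.sum_mul _ _ _
        _ ≤ ∑ B ∈ Q, 3 * numBPT n := by
            refine Finset.sum_le_sum (fun B hB => ?_)
            rw [Finset.mem_filter] at hB
            obtain ⟨hB, h3, h3'⟩ := hB
            have hsubB := (hH₀.sub B hB).1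
            have h1 := hier_count _ B (hH₀.sub B hB).2 hsubB
            have h2 := Finset.card_sdiff_add_card_eq_card hsubB
            have h4 : (Finset.univ.erase r).card = n - 1 := by simp
            have h5 : B.card + (Bᶜ).card = n := by
              rw [Finset.card_add_card_compl]; simp
            obtain ⟨b, hb⟩ := Nat.exists_eq_add_of_le h3
            obtain ⟨c, hc⟩ := Nat.exists_eq_add_of_le h3'
            have e1 : B.card + 1 = b + 4 := by omega
            have e2 : (Finset.univ.erase r \ B).card + 2 = c + 4 := by omega
            rw [e1, e2] at h1
            have e3 : n = b + c + 6 := by omega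
            have e4 : 2 * n - 5 = 2 * (b + c) + 7 := by omega
            have e5 : 2 * n - 7 = 2 * (b + c) + 5 := by omega
            rw [e4, e5]
            refine (Nat.mul_le_mul_right _ h1).trans ?_
            have := numBPT_conv b c
            rwa [← e3] at this
        _ = Q.card * (3 * numBPT n) := by rw [Finset.sum_const, smul_eq_mul]
        _ ≤ _ := Nat.mul_le_mul_right _ hQ
    · intro hn6
      have : Q = ∅ := by
        apply Finset.filter_eq_empty_iff.2
        intro B _ h
        have h5 : B.card + (Bᶜ).card = n := by
          rw [Finset.card_add_card_compl]; simp
        omega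
      rw [this] at hcard
      simpa using hcard
  obtain ⟨h1, h2⟩ := hmain
  have hnpos : (0 : ℝ) < n := by exact_mod_cast (by omega : 0 < n)
  have hbpos : (0 : ℝ) < numBPT n := by exact_mod_cast hpos
  rw [div_le_div_iff₀ hbpos hnpos]
  by_cases hn6 : n < 6
  · rw [h2 hn6]
    simp
  · obtain ⟨m, rfl⟩ := Nat.exists_eq_add_of_le (not_lt.1 hn6)
    have e4 : 2 * (6 + m) - 5 = 2 * m + 7 := by omega
    have e5 : 2 * (6 + m) - 7 = 2 * m + 5 := by omega
    have e6 : 2 * (6 + m) - 3 = 2 * m + 9 := by omega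
    rw [e4, e5, e6] at h1
    have h3 : F.card * (6 + m) ≤ 10 * numBPT (6 + m) := by
      have hW : 0 < (2 * m + 7) * (2 * m + 5) := by positivity
      refine Nat.le_of_mul_le_mul_right ?_ hW
      calc _ = F.card * ((2 * m + 7) * (2 * m + 5)) * (6 + m) := by ring
        _ ≤ (2 * m + 9) * (3 * numBPT (6 + m)) * (6 + m) := Nat.mul_le_mul_right _ h1
        _ = numBPT (6 + m) * (3 * (2 * m + 9) * (6 + m)) := by ring
        _ ≤ numBPT (6 + m) * (10 * ((2 * m + 7) * (2 * m + 5))) := by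
            apply Nat.mul_le_mul_left
            nlinarith
        _ = _ := by ring
    exact_mod_cast h3
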